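/- Fix n ≥ 1, t ≥ 1, and a finite set S ⊂ P^n. If S imposes |S| independent conditions on ℂ[z_0,…,z_n]_{t-1} (i.e., the evaluation map in degree t-1 is surjective onto ℂ^S), then for every point p ∈ P^n \ S there exists a homogeneous polynomial f of degree t vanishing on S with f(p) ≠ 0; equivalently, S is the common zero locus of the degree-t forms through S. -/

import Mathlib

open MvPolynomial Function

/-- Complex projective `n`-space, as the projectivization of `ℂ^{n+1}`. -/
abbrev Pn (n : ℕ) := Projectivization ℂ (Fin (n + 1) → ℂ)

/-- The linear span (as a vector subspace) of a set of projective points. -/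
def pspan {V : Type*} [AddCommGroup V] [Module ℂ V] (E : Set (Projectivization ℂ V)) :
    Submodule ℂ V :=
  Submodule.span ℂ (Projectivization.rep '' E)

/-- `E` minimally spans `q`: `q` lies in the span of `E` but in the span of no proper subset. -/
def MinimallySpans {V : Type*} [AddCommGroup V] [Module ℂ V]
    (E : Set (Projectivization ℂ V)) (q : Projectivization ℂ V) : Prop :=
  q.rep ∈ pspan E ∧ ∀ E' ⊂ E, q.rep ∉ pspan E'

/-- `E ⊂ P^n` imposes `|E|` independent conditions on degree-`t` forms:
the evaluation map from `ℂ[z_0,…,z_n]_t` to `ℂ^E` is surjective. -/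
def ImposesIndep (n t : ℕ) (E : Set (Pn n)) : Prop :=
  Surjective (fun (g : homogeneousSubmodule (Fin (n + 1)) ℂ t) (p : E) =>
    eval (Projectivization.rep (p : Pn n)) (g : MvPolynomial (Fin (n + 1)) ℂ))

/-- The `d`-th power of the linear form with coefficient vector `v`. -/
noncomputable def linPow (n d : ℕ) (v : Fin (n + 1) → ℂ) : MvPolynomial (Fin (n + 1)) ℂ :=
  (∑ i, C (v i) * X i) ^ d

/-- The span of the image under the degree-`d` Veronese embedding of a set `S ⊂ P^n`,
as a subspace of the polynomial ring. -/
noncomputable def veroneseSpan (n d : ℕ) (S : Set (Pn n)) : Submodule ℂ (MvPolynomial (Fin (n + 1)) ℂ) :=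
  Submodule.span ℂ ((fun p : Pn n => linPow n d (Projectivization.rep p)) '' S)

/-- `ν_d(S)` minimally spans the point `q` of `P^r = P(ℂ[z_0,…,z_n]_d)`. -/
def MinSpansVer (n d : ℕ) (S : Set (Pn n))
    (q : Projectivization ℂ (homogeneousSubmodule (Fin (n + 1)) ℂ d)) : Prop :=
  (Projectivization.rep q).1 ∈ veroneseSpan n d S ∧
    ∀ S' ⊂ S, (Projectivization.rep q).1 ∉ veroneseSpan n d S'

/-- `S ⊂ P^m` is in linearly general position: every subset of cardinality at most `m + 1`
is linearly independent. -/
def LGP (m : ℕ) (S : Set (Pn m)) : Prop :=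
  ∀ B ⊆ S, B.Finite → B.ncard ≤ m + 1 →
    LinearIndependent ℂ (fun p : B => Projectivization.rep (p : Pn m))

/-- The evaluation linear map from degree-`t` forms to `ℂ^E`. -/
noncomputable def evalLM (n t : ℕ) (E : Set (Pn n)) :
    homogeneousSubmodule (Fin (n + 1)) ℂ t →ₗ[ℂ] (E → ℂ) where
  toFun g p := eval (Projectivization.rep (p : Pn n)) g.1
  map_add' g₁ g₂ := by funext p; simp
  map_smul' c g := by funext p; simp [MvPolynomial.smul_eval]

/-- Distinct points of projective space are separated by a linear form. -/
theorem exists_linear_form_eval_eq_zero_ne_zero {n : ℕ} {a p : Pn n} (hap : a ≠ p) :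
    ∃ l : MvPolynomial (Fin (n + 1)) ℂ, l.IsHomogeneous 1 ∧
      eval a.rep l = 0 ∧ eval p.rep l ≠ 0 := by
  obtain ⟨i, hi⟩ := Function.ne_iff.mp a.rep_nonzero
  simp only [Pi.zero_apply] at hi
  by_contra! h
  have key (j : Fin (n + 1)) : a.rep i * p.rep j - a.rep j * p.rep i = 0 := by
    have := h (C (a.rep i) * X j - C (a.rep j) * X i)
      ((isHomogeneous_C_mul_X _ _).sub (isHomogeneous_C_mul_X _ _))
      (by simp; ring)
    simpa using this
  have hp : (p.rep i / a.rep i) • a.rep = p.rep := by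
    funext j
    simp only [Pi.smul_apply, smul_eq_mul]
    field_simp
    linear_combination -key j
  apply hap
  rw [← a.mk_rep, ← p.mk_rep]
  exact ((Projectivization.mk_eq_mk_iff' ℂ _ _ p.rep_nonzero a.rep_nonzero).mpr ⟨_, hp⟩).symm

/-- Castelnuovo–Mumford consequence: if `S` imposes independent conditions
on degree-`(t-1)` forms, then every point outside `S` is avoided by a degree-`t` form
vanishing on `S`; i.e. `S` is cut out by the degree-`t` forms through it. -/
theorem stmt_15 (n t : ℕ) (hn : 1 ≤ n) (ht : 1 ≤ t) (S : Set (Pn n)) (hS : S.Finite)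
    (hind : ImposesIndep n (t - 1) S) :
    ∀ p : Pn n, p ∉ S → ∃ f ∈ homogeneousSubmodule (Fin (n + 1)) ℂ t,
      (∀ a ∈ S, eval (Projectivization.rep a) f = 0) ∧
        eval (Projectivization.rep p) f ≠ 0 := by
  classical
  intro p hp
  have := hS.fintype
  choose g hg using fun a : S => hind (Pi.single a 1)
  have hg_eval (a b : S) : eval (Projectivization.rep (b : Pn n)) (g a).1 =
      (Pi.single a 1 : S → ℂ) b := congrFun (hg a) b
  have hdeg : t - 1 + 1 = t := Nat.sub_add_cancel ht
  by_cases hex : ∃ a : S, eval p.rep (g a).1 ≠ 0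
  · obtain ⟨a, ha⟩ := hex
    have hap : (a : Pn n) ≠ p := fun h => hp (h ▸ a.2)
    obtain ⟨l, hl, hla, hlp⟩ := exists_linear_form_eval_eq_zero_ne_zero hap
    refine ⟨(g a).1 * l, ?_, fun b hb => ?_, ?_⟩
    · have h := ((mem_homogeneousSubmodule _ _).mp (g a).2).mul hl
      rwa [hdeg] at h
    · rw [map_mul]
      by_cases hab : (⟨b, hb⟩ : S) = a
      · subst hab
        rw [hla, mul_zero]
      · rw [hg_eval a ⟨b, hb⟩, Pi.single_eq_of_ne hab, zero_mul]
    · rw [map_mul]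
      exact mul_ne_zero ha hlp
  · push Not at hex
    obtain ⟨i, hi⟩ := Function.ne_iff.mp p.rep_nonzero
    simp only [Pi.zero_apply] at hi
    let r : MvPolynomial (Fin (n + 1)) ℂ :=
      X i ^ (t - 1) - ∑ a : S, (Projectivization.rep (a : Pn n) i ^ (t - 1)) • (g a).1
    have hr : r ∈ homogeneousSubmodule (Fin (n + 1)) ℂ (t - 1) :=
      Submodule.sub_mem _ ((mem_homogeneousSubmodule _ _).mpr (isHomogeneous_X_pow i _))
        (Submodule.sum_mem _ fun a _ => Submodule.smul_mem _ _ (g a).2)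
    refine ⟨r * X i, ?_, fun b hb => ?_, ?_⟩
    · have h := ((mem_homogeneousSubmodule _ _).mp hr).mul (isHomogeneous_X ℂ i)
      rwa [hdeg] at h
    · have hrb : eval b.rep r = 0 := by
        simp only [r, map_sub, map_pow, eval_X, map_sum, smul_eval]
        simp [fun a => hg_eval a ⟨b, hb⟩, Pi.single_apply]
      rw [map_mul, hrb, zero_mul]
    · have hrp : eval p.rep r = p.rep i ^ (t - 1) := by
        simp [r, smul_eval, hex]
      rw [map_mul, hrp, eval_X]
      exact mul_ne_zero (pow_ne_zero _ hi) hi
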